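/- Let K be an algebraically closed field of characteristic 2 and let X ⊂ ℙ³ be the quartic surface defined by x₀³x₁ + x₀²x₁² + x₀x₁³ + x₀²x₁x₂ + x₀x₁²x₂ + x₀²x₂² + x₀x₁x₂² + x₁x₂³ + x₀x₁²x₃ + x₁x₂²x₃ + x₁²x₃² + x₀x₂x₃² = 0. Then the line ℓ : x₀ = x₁ = 0 lies on X, and exactly 12 lines lying on X and distinct from ℓ meet ℓ at a point that is a smooth point of X. -/

import Mathlib

open MvPolynomial

/-- The quartic of the example with a separable quasi-elliptic line of degree 2 and
valency 12. -/
noncomputable def exQuartic (K : Type*) [Field K] : MvPolynomial (Fin 4) K :=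
  X 0 ^ 3 * X 1 + X 0 ^ 2 * X 1 ^ 2 + X 0 * X 1 ^ 3 + X 0 ^ 2 * X 1 * X 2
    + X 0 * X 1 ^ 2 * X 2 + X 0 ^ 2 * X 2 ^ 2 + X 0 * X 1 * X 2 ^ 2 + X 1 * X 2 ^ 3
    + X 0 * X 1 ^ 2 * X 3 + X 1 * X 2 ^ 2 * X 3 + X 1 ^ 2 * X 3 ^ 2 + X 0 * X 2 * X 3 ^ 2

theorem eval_exQuartic {K : Type*} [Field K] (v : Fin 4 → K) :
    eval v (exQuartic K) = v 0 ^ 3 * v 1 + v 0 ^ 2 * v 1 ^ 2 + v 0 * v 1 ^ 3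
      + v 0 ^ 2 * v 1 * v 2 + v 0 * v 1 ^ 2 * v 2 + v 0 ^ 2 * v 2 ^ 2 + v 0 * v 1 * v 2 ^ 2
      + v 1 * v 2 ^ 3 + v 0 * v 1 ^ 2 * v 3 + v 1 * v 2 ^ 2 * v 3 + v 1 ^ 2 * v 3 ^ 2
      + v 0 * v 2 * v 3 ^ 2 := by
  simp [exQuartic]

/-- Restriction of the quartic to the line through `(0, 0, 1, t)` and `(a, b, 0, c)`. -/
theorem eval_exQuartic_combination {K : Type*} [Field K] [CharP K 2] (t a b c r s : K) :
    eval (r • ![0, 0, 1, t] + s • ![a, b, 0, c]) (exQuartic K) =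
      r ^ 3 * s * (a * t ^ 2 + b * (1 + t)) + r ^ 2 * s ^ 2 * (a ^ 2 + a * b + b * c + b ^ 2 * t ^ 2)
      + r * s ^ 3 * (a * (a * b + b ^ 2 + b ^ 2 * t + c ^ 2))
      + s ^ 4 * (a ^ 3 * b + a ^ 2 * b ^ 2 + a * b ^ 3 + a * b ^ 2 * c + b ^ 2 * c ^ 2) := by
  have h2 : (2 : K) = 0 := CharTwo.two_eq_zero
  rw [eval_exQuartic]
  simp
  linear_combination (r * s ^ 3 * b ^ 2 * t * c + r ^ 2 * s ^ 2 * a * t * c) * h2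

theorem coeffs_eq_zero_of_forall {K : Type*} [Field K] [Infinite K] {e₁ e₂ e₃ e₄ : K}
    (h : ∀ s : K, s * e₁ + s ^ 2 * e₂ + s ^ 3 * e₃ + s ^ 4 * e₄ = 0) :
    e₁ = 0 ∧ e₂ = 0 ∧ e₃ = 0 ∧ e₄ = 0 := by
  let p : Polynomial K := Polynomial.C e₁ * Polynomial.X + Polynomial.C e₂ * Polynomial.X ^ 2
    + Polynomial.C e₃ * Polynomial.X ^ 3 + Polynomial.C e₄ * Polynomial.X ^ 4
  have hp : p = 0 := Polynomial.funext fun s => by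
    simp only [p, Polynomial.eval_add, Polynomial.eval_mul, Polynomial.eval_C, Polynomial.eval_X,
      Polynomial.eval_pow, Polynomial.eval_zero]
    linear_combination h s
  have key (n : ℕ) : p.coeff n = 0 := by rw [hp, Polynomial.coeff_zero]
  have h1 := key 1
  have h2 := key 2
  have h3 := key 3
  have h4 := key 4
  simp [p, Polynomial.coeff_X_pow] at h1 h2 h3 h4
  exact ⟨h1, h2, h3, h4⟩

theorem mem_line_iff {K : Type*} [Field K] (v : Fin 4 → K) :
    v ∈ Submodule.span K {![0, 0, 1, 0], ![0, 0, 0, 1]} ↔ v 0 = 0 ∧ v 1 = 0 := by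
  rw [Submodule.mem_span_pair]
  constructor
  · rintro ⟨r, s, rfl⟩
    simp
  · rintro ⟨h0, h1⟩
    refine ⟨v 2, v 3, ?_⟩
    ext i
    fin_cases i <;> simp [h0, h1]

theorem finrank_span_pair_eq_two {K V : Type*} [Field K] [AddCommGroup V] [Module K V] {x y : V}
    (h : LinearIndependent K ![x, y]) : Module.finrank K (Submodule.span K {x, y}) = 2 := by
  have h' := finrank_span_eq_card h
  rwa [Matrix.range_cons_cons_empty, Fintype.card_fin] at h'

theorem finrank_line {K : Type*} [Field K] :
    Module.finrank K (Submodule.span K {![0, 0, 1, 0], ![0, 0, 0, 1]} :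
      Submodule K (Fin 4 → K)) = 2 := by
  have hli : LinearIndependent K ![(![0, 0, 1, 0] : Fin 4 → K), ![0, 0, 0, 1]] := by
    rw [LinearIndependent.pair_iff]
    intro r s h
    exact ⟨by simpa using congrFun h 2, by simpa using congrFun h 3⟩
  exact finrank_span_pair_eq_two hli

/-- The polynomial whose roots parametrize the points of `ℓ` through which a further line of the
quartic passes. -/
noncomputable def valencyPoly (K : Type*) [Field K] : Polynomial K :=
  Polynomial.X ^ 12 + Polynomial.X ^ 9 + Polynomial.X ^ 8 + Polynomial.X ^ 7 + 1

theorem natDegree_valencyPoly {K : Type*} [Field K] : (valencyPoly K).natDegree = 12 := by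
  unfold valencyPoly
  compute_degree!

theorem separable_valencyPoly {K : Type*} [Field K] [CharP K 2] : (valencyPoly K).Separable := by
  have h2 : (2 : Polynomial K) = 0 := CharTwo.two_eq_zero
  refine ⟨1, Polynomial.X ^ 4 + Polynomial.X ^ 2 + Polynomial.X, ?_⟩
  simp only [valencyPoly, Polynomial.derivative_add, Polynomial.derivative_X_pow,
    Polynomial.derivative_one, map_natCast]
  push_cast
  linear_combination (6 * Polynomial.X ^ 15 + 6 * Polynomial.X ^ 13 + 11 * Polynomial.X ^ 12
    + 4 * Polynomial.X ^ 11 + 8 * Polynomial.X ^ 10 + 9 * Polynomial.X ^ 9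
    + 8 * Polynomial.X ^ 8 + 4 * Polynomial.X ^ 7) * h2

theorem ncard_roots_valencyPoly {K : Type*} [Field K] [IsAlgClosed K] [CharP K 2] :
    {t : K | t ^ 12 + t ^ 9 + t ^ 8 + t ^ 7 + 1 = 0}.ncard = 12 := by
  classical
  have hne : valencyPoly K ≠ 0 := separable_valencyPoly.ne_zero
  have hset : {t : K | t ^ 12 + t ^ 9 + t ^ 8 + t ^ 7 + 1 = 0} =
      ((valencyPoly K).roots.toFinset : Set K) := by
    ext t
    rw [Finset.mem_coe, Multiset.mem_toFinset, Polynomial.mem_roots hne]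
    simp [Polynomial.IsRoot, valencyPoly]
  rw [hset, Set.ncard_coe_finset,
    Multiset.toFinset_card_of_nodup (Polynomial.nodup_roots separable_valencyPoly),
    ← (IsAlgClosed.splits (valencyPoly K)).natDegree_eq_card_roots, natDegree_valencyPoly]

/-- The line on the quartic meeting `ℓ` at `(0, 0, 1, t)`, for `t` a root of `valencyPoly`. -/
noncomputable def valencyLine {K : Type*} [Field K] (t : K) : Submodule K (Fin 4 → K) :=
  Submodule.span K {![0, 0, 1, t], ![1 + t, t ^ 2, 0, (1 + t ^ 3 + t ^ 6) / t ^ 2]}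

theorem finrank_valencyLine {K : Type*} [Field K] {t : K} (ht : t ≠ 0) :
    Module.finrank K (valencyLine t) = 2 := by
  have hli : LinearIndependent K ![(![0, 0, 1, t] : Fin 4 → K),
      ![1 + t, t ^ 2, 0, (1 + t ^ 3 + t ^ 6) / t ^ 2]] := by
    rw [LinearIndependent.pair_iff]
    intro r s h
    exact ⟨by simpa using congrFun h 2, by simpa [ht] using congrFun h 1⟩
  exact finrank_span_pair_eq_two hli

theorem valencyLine_injOn {K : Type*} [Field K] :
    Set.InjOn (valencyLine (K := K)) {t | t ≠ 0} := by
  intro t _ t' ht' h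
  have hm : ![0, 0, 1, t] ∈ valencyLine t' := h ▸ Submodule.subset_span (by simp)
  obtain ⟨r, s, hrs⟩ := Submodule.mem_span_pair.1 hm
  have hs : s = 0 := by simpa [show t' ≠ 0 from ht'] using congrFun hrs 1
  have hr : r = 1 := by simpa using congrFun hrs 2
  simpa [hs, hr] using (congrFun hrs 3).symm

theorem smooth_iff_of_mem_line {K : Type*} [Field K] {v : Fin 4 → K} (h0 : v 0 = 0)
    (h1 : v 1 = 0) : (∃ i, eval v (pderiv i (exQuartic K)) ≠ 0) ↔
      v 2 * v 3 ^ 2 ≠ 0 ∨ v 2 ^ 2 * (v 2 + v 3) ≠ 0 := by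
  have e0 : eval v (pderiv 0 (exQuartic K)) = v 2 * v 3 ^ 2 := by
    simp [exQuartic, pderiv_X, h0, h1, Derivation.leibniz, Derivation.leibniz_pow]
    ring
  have e1 : eval v (pderiv 1 (exQuartic K)) = v 2 ^ 2 * (v 2 + v 3) := by
    simp [exQuartic, pderiv_X, h0, h1, Derivation.leibniz, Derivation.leibniz_pow]
    ring
  have e2 : eval v (pderiv 2 (exQuartic K)) = 0 := by
    simp [exQuartic, pderiv_X, h0, h1, Derivation.leibniz, Derivation.leibniz_pow]
  have e3 : eval v (pderiv 3 (exQuartic K)) = 0 := by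
    simp [exQuartic, pderiv_X, h0, h1, Derivation.leibniz, Derivation.leibniz_pow]
  simp [Fin.exists_fin_succ, e0, e1, e2, e3]

theorem eval_exQuartic_of_mem_valencyLine {K : Type*} [Field K] [CharP K 2] {t : K}
    (ht : t ^ 12 + t ^ 9 + t ^ 8 + t ^ 7 + 1 = 0) {v : Fin 4 → K} (hv : v ∈ valencyLine t) :
    eval v (exQuartic K) = 0 := by
  have h2 : (2 : K) = 0 := CharTwo.two_eq_zero
  have ht0 : t ≠ 0 := by
    rintro rfl
    simp at ht
  obtain ⟨r, s, rfl⟩ := Submodule.mem_span_pair.1 hv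
  obtain ⟨c, hc⟩ : ∃ c, c = (1 + t ^ 3 + t ^ 6) / t ^ 2 := ⟨_, rfl⟩
  rw [← hc, eval_exQuartic_combination]
  have hc' : t ^ 2 * c = 1 + t ^ 3 + t ^ 6 := by
    rw [hc]
    field_simp
  have hc2 : c ^ 2 = t ^ 2 + t ^ 3 + t ^ 4 + t ^ 5 := by
    refine mul_left_cancel₀ (pow_ne_zero 4 ht0) ?_
    linear_combination (t ^ 2 * c + 1 + t ^ 3 + t ^ 6) * hc' + ht
      + (t ^ 3 + t ^ 6 - t ^ 7 - t ^ 8) * h2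
  clear hc hv
  have q2 : (1 + t) ^ 2 + (1 + t) * t ^ 2 + t ^ 2 * c + (t ^ 2) ^ 2 * t ^ 2 = 0 := by grind
  have q3 : (1 + t) * t ^ 2 + (t ^ 2) ^ 2 + (t ^ 2) ^ 2 * t + c ^ 2 = 0 := by grind
  have q1 : (1 + t) * t ^ 2 + t ^ 2 * (1 + t) = 0 := by grind
  have q4 : (1 + t) ^ 3 * t ^ 2 + (1 + t) ^ 2 * (t ^ 2) ^ 2 + (1 + t) * (t ^ 2) ^ 3
      + (1 + t) * (t ^ 2) ^ 2 * c + (t ^ 2) ^ 2 * c ^ 2 = 0 := by grind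
  rw [q1, q2, q3, q4]
  ring

/-- A line on the quartic through `(0, 0, 1, t)` other than `ℓ` is determined by `t`. -/
theorem direction_of_line {K : Type*} [Field K] [Infinite K] [CharP K 2] {t a b c : K}
    (hab : ¬(a = 0 ∧ b = 0))
    (h : ∀ s : K, eval ((1 : K) • ![0, 0, 1, t] + s • ![a, b, 0, c]) (exQuartic K) = 0) :
    t ^ 12 + t ^ 9 + t ^ 8 + t ^ 7 + 1 = 0 ∧ ∃ k : K, k ≠ 0 ∧
      k • ![a, b, 0, c] = ![1 + t, t ^ 2, 0, (1 + t ^ 3 + t ^ 6) / t ^ 2] := by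
  have h2 : (2 : K) = 0 := CharTwo.two_eq_zero
  simp only [eval_exQuartic_combination] at h
  obtain ⟨h1', h2', h3', h4'⟩ := coeffs_eq_zero_of_forall
    (e₁ := a * t ^ 2 + b * (1 + t)) (e₂ := a ^ 2 + a * b + b * c + b ^ 2 * t ^ 2)
    (e₃ := a * (a * b + b ^ 2 + b ^ 2 * t + c ^ 2))
    (e₄ := a ^ 3 * b + a ^ 2 * b ^ 2 + a * b ^ 3 + a * b ^ 2 * c + b ^ 2 * c ^ 2) fun s => by
    linear_combination h s
  clear h
  have ht : t ≠ 0 := by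
    rintro rfl
    have hb : b = 0 := by simpa using h1'
    subst hb
    have ha : a = 0 := by simpa using h2'
    exact hab ⟨ha, rfl⟩
  have hb : b ≠ 0 := by
    rintro rfl
    have ha : a = 0 := by simpa [ht] using h1'
    exact hab ⟨ha, rfl⟩
  obtain ⟨k, hk, rfl⟩ : ∃ k, k ≠ 0 ∧ b = k * t ^ 2 := ⟨b / t ^ 2, by positivity, by field_simp⟩
  obtain rfl : a = k * (1 + t) := by
    refine mul_right_cancel₀ (pow_ne_zero 2 ht) ?_
    grind
  obtain ⟨d, rfl⟩ : ∃ d, c = k * d := ⟨c / k, by field_simp⟩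
  have g2 : t ^ 2 * d = 1 + t ^ 3 + t ^ 6 := by
    refine mul_left_cancel₀ (pow_ne_zero 2 hk) ?_
    grind
  have hd : d = (1 + t ^ 3 + t ^ 6) / t ^ 2 := by
    field_simp
    linear_combination g2
  refine ⟨?_, k⁻¹, inv_ne_zero hk, ?_⟩
  · have g3 : (1 + t) * (t ^ 2 * (1 + t) + t ^ 4 + t ^ 5 + d ^ 2) = 0 := by
      refine mul_left_cancel₀ (pow_ne_zero 3 hk) ?_
      linear_combination h3'
    have g4 : (1 + t) ^ 3 * t ^ 2 + (1 + t) ^ 2 * t ^ 4 + (1 + t) * t ^ 6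
        + (1 + t) * t ^ 4 * d + t ^ 4 * d ^ 2 = 0 := by
      refine mul_left_cancel₀ (pow_ne_zero 4 hk) ?_
      linear_combination h4'
    rcases mul_eq_zero.1 g3 with g | g
    · grind
    · linear_combination t ^ 4 * g - (t ^ 2 * d + (1 + t ^ 3 + t ^ 6)) * g2
        - (t ^ 3 + 2 * t ^ 6 + t ^ 9) * h2
  · rw [← hd]
    ext i
    fin_cases i <;> simp [hk]

/-- The lines counted by the valency of `ℓ` are the lines `valencyLine t`. -/
theorem setOf_lines_eq_image_valencyLine {K : Type*} [Field K] [Infinite K] [CharP K 2] :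
    {W : Submodule K (Fin 4 → K) |
        Module.finrank K W = 2 ∧ (∀ v ∈ W, eval v (exQuartic K) = 0) ∧
        W ≠ Submodule.span K {![0, 0, 1, 0], ![0, 0, 0, 1]} ∧
        ∃ v : Fin 4 → K, v ≠ 0 ∧ v ∈ W ∧
          v ∈ Submodule.span K {![0, 0, 1, 0], ![0, 0, 0, 1]} ∧
          ∃ i : Fin 4, eval v (pderiv i (exQuartic K)) ≠ 0} =
      valencyLine '' {t : K | t ^ 12 + t ^ 9 + t ^ 8 + t ^ 7 + 1 = 0} := by
  ext W
  constructor
  · rintro ⟨hW, hX, hne, v, -, hvW, hvl, hsm⟩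
    obtain ⟨hv0, hv1⟩ := (mem_line_iff v).1 hvl
    rw [smooth_iff_of_mem_line hv0 hv1] at hsm
    have hv2 : v 2 ≠ 0 := by
      intro h
      simp [h] at hsm
    obtain ⟨t, hu⟩ : ∃ t, ![0, 0, 1, t] ∈ W := by
      refine ⟨v 3 / v 2, ?_⟩
      convert W.smul_mem (v 2)⁻¹ hvW using 1
      ext i
      fin_cases i <;> simp [hv0, hv1, hv2, div_eq_inv_mul]
    obtain ⟨w, hwW, hwl⟩ : ∃ w ∈ W, w ∉ Submodule.span K {![0, 0, 1, 0], ![0, 0, 0, 1]} := by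
      by_contra! hle
      exact hne (Submodule.eq_of_le_of_finrank_eq hle (hW.trans finrank_line.symm))
    have hd : ![w 0, w 1, 0, w 3 - w 2 * t] ∈ W := by
      convert W.sub_mem hwW (W.smul_mem (w 2) hu) using 1
      ext i
      fin_cases i <;> simp
    obtain ⟨ht, k, -, hk⟩ := direction_of_line (fun h => hwl ((mem_line_iff w).2 h))
      fun s => hX _ (W.add_mem (W.smul_mem 1 hu) (W.smul_mem s hd))
    have ht0 : t ≠ 0 := by
      rintro rfl
      simp at ht
    refine ⟨t, ht, Submodule.eq_of_le_of_finrank_eq ?_ ((finrank_valencyLine ht0).trans hW.symm)⟩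
    rw [valencyLine, Submodule.span_le, Set.insert_subset_iff, Set.singleton_subset_iff]
    exact ⟨hu, hk ▸ W.smul_mem k hd⟩
  · rintro ⟨t, ht, rfl⟩
    have ht0 : t ≠ 0 := by
      rintro rfl
      simp at ht
    refine ⟨finrank_valencyLine ht0, fun v => eval_exQuartic_of_mem_valencyLine ht, ?_,
      ![0, 0, 1, t], fun h => by simpa using congrFun h 2, Submodule.subset_span (by simp),
      (mem_line_iff _).2 (by simp), (smooth_iff_of_mem_line (by simp) (by simp)).2 ?_⟩
    · intro h
      have hm : ![1 + t, t ^ 2, 0, (1 + t ^ 3 + t ^ 6) / t ^ 2] ∈ valencyLine t :=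
        Submodule.subset_span (by simp)
      rw [h, mem_line_iff] at hm
      simp [ht0] at hm
    · simp [ht0]

/-- Over an algebraically closed field of characteristic 2, the line
`ℓ : x₀ = x₁ = 0` lies on the quartic above, and exactly 12 lines on the quartic,
distinct from `ℓ`, meet `ℓ` at a point that is a smooth point of the surface.
Lines are 2-dimensional subspaces of `K⁴`; points of ℙ³ are nonzero vectors up to
scaling; a point is smooth if some partial derivative of the defining polynomial does
not vanish there. -/
theorem exQuartic_valency_12 (K : Type*) [Field K] [IsAlgClosed K] [CharP K 2] :
    (∀ v ∈ (Submodule.span K {![0, 0, 1, 0], ![0, 0, 0, 1]} :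
        Submodule K (Fin 4 → K)), eval v (exQuartic K) = 0) ∧
    {W : Submodule K (Fin 4 → K) |
        Module.finrank K W = 2 ∧ (∀ v ∈ W, eval v (exQuartic K) = 0) ∧
        W ≠ Submodule.span K {![0, 0, 1, 0], ![0, 0, 0, 1]} ∧
        ∃ v : Fin 4 → K, v ≠ 0 ∧ v ∈ W ∧
          v ∈ Submodule.span K {![0, 0, 1, 0], ![0, 0, 0, 1]} ∧
          ∃ i : Fin 4, eval v (pderiv i (exQuartic K)) ≠ 0}.Finite ∧
    {W : Submodule K (Fin 4 → K) |
        Module.finrank K W = 2 ∧ (∀ v ∈ W, eval v (exQuartic K) = 0) ∧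
        W ≠ Submodule.span K {![0, 0, 1, 0], ![0, 0, 0, 1]} ∧
        ∃ v : Fin 4 → K, v ≠ 0 ∧ v ∈ W ∧
          v ∈ Submodule.span K {![0, 0, 1, 0], ![0, 0, 0, 1]} ∧
          ∃ i : Fin 4, eval v (pderiv i (exQuartic K)) ≠ 0}.ncard = 12 := by
  have hcard := ncard_roots_valencyPoly (K := K)
  refine ⟨fun v hv => ?_, ?_⟩
  · obtain ⟨h0, h1⟩ := (mem_line_iff v).1 hv
    simp [eval_exQuartic, h0, h1]
  · have : Infinite K := IsAlgClosed.instInfinite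
    rw [setOf_lines_eq_image_valencyLine]
    refine ⟨(Set.finite_of_ncard_pos (by omega)).image _, ?_⟩
    rw [(valencyLine_injOn.mono ?_).ncard_image, hcard]
    rintro t ht rfl
    simp at ht
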